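/- Let m ≡ 2 (mod 3) be an odd positive integer such that 9m² + 2m is square-free and such that m has a prime divisor p ≥ 5. Then the class number of Q(√(9m²+2m)) is at least 4. -/

import Mathlib

open NumberField

/-- The Diophantine input: small values of `x² - d y²` come from rational integers times units. -/
lemma pell_small (m : ℤ) (hm : 5 ≤ m) (k : ℕ) : ∀ x y : ℤ, y.natAbs = k →
    |x ^ 2 - (9 * m ^ 2 + 2 * m) * y ^ 2| ≤ 9 →
    ∃ a : ℤ, a ∣ x ∧ a ∣ y ∧ x ^ 2 - (9 * m ^ 2 + 2 * m) * y ^ 2 = a ^ 2 := by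
  induction k using Nat.strong_induction_on with
  | _ k ih =>
  -- reduce to the case of nonnegative x and y
  suffices H : ∀ x y : ℤ, 0 ≤ x → 0 ≤ y → y.natAbs = k →
      |x ^ 2 - (9 * m ^ 2 + 2 * m) * y ^ 2| ≤ 9 →
      ∃ a : ℤ, a ∣ x ∧ a ∣ y ∧ x ^ 2 - (9 * m ^ 2 + 2 * m) * y ^ 2 = a ^ 2 by
    intro x y hy h
    have := H |x| |y| (abs_nonneg _) (abs_nonneg _) (by rw [Int.natAbs_abs]; exact hy)
      (by simpa using h)
    simpa using this
  intro x y hx hy hk h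
  by_cases hy0 : y = 0
  · subst hy0
    exact ⟨x, dvd_rfl, dvd_zero _, by ring⟩
  have hy1 : 1 ≤ y := by omega
  by_cases hlt : ((9 * m + 1) * y - 3 * x).natAbs < k
  · obtain ⟨a, ⟨u, hu⟩, ⟨v, hv⟩, hn⟩ := ih _ hlt
      ((9 * m + 1) * x - 3 * (9 * m ^ 2 + 2 * m) * y)
      ((9 * m + 1) * y - 3 * x) rfl (by
        convert h using 2
        ring)
    refine ⟨a, ⟨(9 * m + 1) * u + 3 * (9 * m ^ 2 + 2 * m) * v, ?_⟩,
      ⟨(9 * m + 1) * v + 3 * u, ?_⟩, ?_⟩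
    · linear_combination (9 * m + 1) * hu + 3 * (9 * m ^ 2 + 2 * m) * hv
    · linear_combination (9 * m + 1) * hv + 3 * hu
    · rw [← hn]; ring
  · exfalso
    have h1 : y ≤ |(9 * m + 1) * y - 3 * x| := by
      rw [not_lt] at hlt
      rw [← Int.natCast_natAbs]
      omega
    rw [abs_le] at h
    have hyy : 1 ≤ y ^ 2 := by nlinarith
    have hmy : 5 * 1 ≤ m * y ^ 2 := by gcongr
    rcases le_abs.mp h1 with h2 | h2
    · have h3 : x ≤ 3 * m * y := by linarith
      have h4 : x ^ 2 ≤ (3 * m * y) ^ 2 := by gcongr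
      nlinarith
    · have h3 : (9 * m + 2) * y ≤ 3 * x := by linarith
      have h4 : ((9 * m + 2) * y) ^ 2 ≤ (3 * x) ^ 2 := by
        have : 0 ≤ (9 * m + 2) * y := by positivity
        gcongr
      nlinarith

lemma norm_small (m : ℤ) (hm : 5 ≤ m) (β : ℤ√(9 * m ^ 2 + 2 * m)) (h : |β.norm| ≤ 9) :
    ∃ a : ℤ, (a : ℤ√(9 * m ^ 2 + 2 * m)) ∣ β ∧ β.norm = a ^ 2 := by
  have e : β.norm = β.re ^ 2 - (9 * m ^ 2 + 2 * m) * β.im ^ 2 := by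
    rw [Zsqrtd.norm_def]; ring
  rw [e] at h ⊢
  obtain ⟨a, h1, h2, h3⟩ := pell_small m hm _ β.re β.im rfl h
  exact ⟨a, (Zsqrtd.intCast_dvd _ _).2 ⟨h1, h2⟩, h3⟩

open Zsqrtd in
lemma norm_of_conj {d : ℤ} (β : ℤ√d) (n : ℤ)
    (h : Ideal.span {β} * Ideal.span {star β} = Ideal.span {(n : ℤ√d)}) :
    |β.norm| = |n| := by
  rw [Ideal.span_singleton_mul_span_singleton, ← norm_eq_mul_conj] at h
  have h1 : ((β.norm : ℤ) : ℤ√d) ∣ (n : ℤ√d) := by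
    rw [← Ideal.span_singleton_le_span_singleton, h]
  have h2 : (n : ℤ√d) ∣ ((β.norm : ℤ) : ℤ√d) := by
    rw [← Ideal.span_singleton_le_span_singleton, h]
  rw [Zsqrtd.intCast_dvd_intCast] at h1 h2
  exact abs_eq_abs.2 (Int.associated_iff.1 (associated_of_dvd_dvd h1 h2))

open Zsqrtd in
lemma map_star_pair {d : ℤ} (a : ℤ) :
    Ideal.map (starRingEnd (ℤ√d)) (Ideal.span {(a : ℤ√d), 1 + sqrtd}) =
      Ideal.span {(a : ℤ√d), 1 - sqrtd} := by
  rw [Ideal.map_span, Set.image_pair]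
  have h1 : starRingEnd (ℤ√d) (a : ℤ√d) = a := by simp
  have h2 : starRingEnd (ℤ√d) (1 + sqrtd) = 1 - sqrtd := by
    ext <;> simp [starRingEnd_apply]
  rw [h1, h2]

open Zsqrtd in
lemma pair_three {d : ℤ} (hd : d % 3 = 1) :
    Ideal.span {((3 : ℤ) : ℤ√d), 1 + sqrtd} * Ideal.span {((3 : ℤ) : ℤ√d), 1 - sqrtd} =
      Ideal.span {((3 : ℤ) : ℤ√d)} := by
  obtain ⟨k, hk⟩ : ∃ k, d = 3 * k + 1 := ⟨d / 3, by omega⟩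
  have hs : (sqrtd : ℤ√d) * sqrtd = 3 * (k : ℤ√d) + 1 := by
    rw [dmuld, hk]; push_cast; rfl
  rw [Ideal.span_pair_mul_span_pair]
  apply _root_.le_antisymm
  · rw [Ideal.span_le]
    rintro z (rfl | rfl | rfl | rfl) <;> rw [SetLike.mem_coe, Ideal.mem_span_singleton]
    · exact ⟨_, rfl⟩
    · exact ⟨_, rfl⟩
    · exact ⟨_, mul_comm _ _⟩
    · exact ⟨-(k : ℤ√d), by push_cast; linear_combination -hs⟩
  · rw [Ideal.span_singleton_le_iff_mem]
    have h1 := Ideal.subset_span (s := {((3 : ℤ) : ℤ√d) * ((3 : ℤ) : ℤ√d),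
      ((3 : ℤ) : ℤ√d) * (1 - sqrtd), (1 + sqrtd) * ((3 : ℤ) : ℤ√d),
      (1 + sqrtd) * (1 - sqrtd)})
    have e : ((3 : ℤ) : ℤ√d) = ((3 : ℤ) : ℤ√d) * ((3 : ℤ) : ℤ√d) -
      (((3 : ℤ) : ℤ√d) * (1 - sqrtd) + (1 + sqrtd) * ((3 : ℤ) : ℤ√d)) := by
      push_cast; ring
    have := Ideal.sub_mem _ (h1 (show
      ((3 : ℤ) : ℤ√d) * ((3 : ℤ) : ℤ√d) ∈ _ by simp)) (Ideal.add_mem _ (h1 (show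
      ((3 : ℤ) : ℤ√d) * (1 - sqrtd) ∈ _ by simp)) (h1 (show
      (1 + sqrtd) * ((3 : ℤ) : ℤ√d) ∈ _ by simp)) )
    rwa [← e] at this

open Zsqrtd in
lemma pair_two_eq {d : ℤ} :
    (Ideal.span {((2 : ℤ) : ℤ√d), 1 - sqrtd}) = Ideal.span {((2 : ℤ) : ℤ√d), 1 + sqrtd} := by
  apply _root_.le_antisymm <;> rw [Ideal.span_le] <;> rintro z (rfl | rfl) <;>
    rw [SetLike.mem_coe, Ideal.mem_span_pair]
  · exact ⟨1, 0, by ring⟩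
  · exact ⟨1, -1, by push_cast; ring⟩
  · exact ⟨1, 0, by ring⟩
  · exact ⟨1, -1, by push_cast; ring⟩

open Zsqrtd in
lemma pair_two {d : ℤ} (hd : d % 4 = 3) :
    Ideal.span {((2 : ℤ) : ℤ√d), 1 + sqrtd} * Ideal.span {((2 : ℤ) : ℤ√d), 1 - sqrtd} =
      Ideal.span {((2 : ℤ) : ℤ√d)} := by
  obtain ⟨k, hk⟩ : ∃ k, d = 4 * k + 3 := ⟨d / 4, by omega⟩
  have hs : (sqrtd : ℤ√d) * sqrtd = 4 * (k : ℤ√d) + 3 := by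
    rw [dmuld, hk]; push_cast; rfl
  rw [Ideal.span_pair_mul_span_pair]
  apply _root_.le_antisymm
  · rw [Ideal.span_le]
    rintro z (rfl | rfl | rfl | rfl) <;> rw [SetLike.mem_coe, Ideal.mem_span_singleton]
    · exact ⟨_, rfl⟩
    · exact ⟨_, rfl⟩
    · exact ⟨_, mul_comm _ _⟩
    · exact ⟨-(2 * k + 1 : ℤ√d), by push_cast; linear_combination -hs⟩
  · rw [Ideal.span_singleton_le_iff_mem]
    have h1 := Ideal.subset_span (s := {((2 : ℤ) : ℤ√d) * ((2 : ℤ) : ℤ√d),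
      ((2 : ℤ) : ℤ√d) * (1 - sqrtd), (1 + sqrtd) * ((2 : ℤ) : ℤ√d),
      (1 + sqrtd) * (1 - sqrtd)})
    have e : ((2 : ℤ) : ℤ√d) = (k + 1 : ℤ√d) * (((2 : ℤ) : ℤ√d) * ((2 : ℤ) : ℤ√d)) +
      (1 + sqrtd) * (1 - sqrtd) := by
      push_cast; linear_combination hs
    have := Ideal.add_mem _ (Ideal.mul_mem_left _ (k + 1 : ℤ√d) (h1 (show
      ((2 : ℤ) : ℤ√d) * ((2 : ℤ) : ℤ√d) ∈ _ by simp))) (h1 (show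
      (1 + sqrtd) * (1 - sqrtd) ∈ _ by simp))
    rwa [← e] at this

open Zsqrtd in
lemma two_not_principal (m : ℤ) (hm : 5 ≤ m) (hd : (9 * m ^ 2 + 2 * m) % 4 = 3) :
    ¬ (Ideal.span {((2 : ℤ) : ℤ√(9 * m ^ 2 + 2 * m)), 1 + sqrtd}).IsPrincipal := by
  rintro ⟨β, hβ⟩
  rw [Ideal.submodule_span_eq] at hβ
  have h1 := map_star_pair (d := 9 * m ^ 2 + 2 * m) 2
  have h2 := pair_two hd
  rw [← h1, hβ, Ideal.map_span, Set.image_singleton, starRingEnd_apply] at h2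
  have h3 := norm_of_conj _ _ h2
  obtain ⟨a, -, ha⟩ := norm_small m hm β (by rw [h3]; norm_num)
  rw [ha, abs_of_nonneg (sq_nonneg a)] at h3
  norm_num at h3
  have : a < 2 := by nlinarith
  have : -2 < a := by nlinarith
  interval_cases a <;> omega

open Zsqrtd in
lemma three_sq_not_principal (m : ℤ) (hm : 5 ≤ m) (hd : (9 * m ^ 2 + 2 * m) % 3 = 1) :
    ¬ ((Ideal.span {((3 : ℤ) : ℤ√(9 * m ^ 2 + 2 * m)), 1 + sqrtd}) ^ 2).IsPrincipal := by
  rintro ⟨β, hβ⟩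
  rw [Ideal.submodule_span_eq] at hβ
  have h1 := map_star_pair (d := 9 * m ^ 2 + 2 * m) 3
  have h2 := congrArg (· ^ 2) (pair_three hd)
  simp only [mul_pow] at h2
  rw [← h1, ← Ideal.map_pow, hβ, Ideal.map_span, Set.image_singleton, starRingEnd_apply,
    Ideal.span_singleton_pow, ← Int.cast_pow] at h2
  have h3 := norm_of_conj _ _ h2
  obtain ⟨a, hab, ha⟩ := norm_small m hm β (by rw [h3]; norm_num)
  rw [ha, abs_of_nonneg (sq_nonneg a)] at h3
  norm_num at h3
  have h9 : (3 : ℤ) ∣ a := by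
    have : (3 : ℤ) ∣ a ^ 2 := ⟨3, by rw [h3]; norm_num⟩
    exact Int.prime_three.dvd_of_dvd_pow this
  have h4 : ((3 : ℤ) : ℤ√(9 * m ^ 2 + 2 * m)) ∣ β :=
    ((Zsqrtd.intCast_dvd_intCast _ _).2 h9).trans hab
  have h5 : (1 + sqrtd : ℤ√(9 * m ^ 2 + 2 * m)) ^ 2 ∈ Ideal.span {β} := by
    rw [← hβ]
    exact Ideal.pow_mem_pow (Ideal.subset_span (by simp)) 2
  rw [Ideal.mem_span_singleton] at h5
  have h6 := ((Zsqrtd.intCast_dvd _ _).1 (h4.trans h5)).2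
  simp [pow_two] at h6

lemma group_four {G : Type*} [Group G] [Fintype G] (a c : G) (ha : a ≠ 1) (ha2 : a * a = 1)
    (hc : c * c ≠ 1) : 4 ≤ Fintype.card G := by
  classical
  have h : ({1, a, c, c⁻¹} : Finset G).card = 4 := by
    have h1 : c ≠ c⁻¹ := fun h => hc (by nth_rewrite 2 [h]; simp)
    have h2 : a ≠ c := by rintro rfl; exact hc ha2
    have h3 : a ≠ c⁻¹ := by
      rintro rfl
      apply hc
      rw [← mul_inv_rev, inv_eq_one] at ha2
      exact ha2
    have h4 : c ≠ 1 := by rintro rfl; simp at hc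
    have h5 : (1 : G) ≠ c⁻¹ := by
      intro h; exact h4 (by simpa using h.symm)
    rw [Finset.card_insert_of_notMem, Finset.card_insert_of_notMem, Finset.card_pair h1]
    · simp [h2, h3]
    · simp [ha.symm, h4.symm, h5]
  rw [← h]
  exact Finset.card_le_univ _

section field

variable {K : Type} [Field K] [NumberField K]

lemma int_of_fixed (hdeg : Module.finrank ℚ K = 2) (σ : K ≃ₐ[ℚ] K) (hσ : σ ≠ 1) (z : K)
    (hz : IsIntegral ℤ z) (h : σ z = z) : ∃ n : ℤ, (n : K) = z := by
  have : Algebra.IsQuadraticExtension ℚ K := ⟨hdeg⟩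
  have hcard : Nat.card (K ≃ₐ[ℚ] K) = 2 := by rw [IsGalois.card_aut_eq_finrank, hdeg]
  obtain ⟨q, hq⟩ := (IsGalois.mem_range_algebraMap_iff_fixed (F := ℚ) z).2 (by
    intro τ
    by_cases h1 : τ = 1
    · simp [h1]
    · have : τ = σ := by
        obtain ⟨x, y, hxy, hu⟩ := Nat.card_eq_two_iff.1 hcard
        have e1 : τ ∈ ({x, y} : Set _) := hu ▸ Set.mem_univ _
        have e2 : σ ∈ ({x, y} : Set _) := hu ▸ Set.mem_univ _
        have e3 : (1 : K ≃ₐ[ℚ] K) ∈ ({x, y} : Set _) := hu ▸ Set.mem_univ _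
        simp only [Set.mem_insert_iff, Set.mem_singleton_iff] at e1 e2 e3
        grind
      rw [this, h])
  rw [← hq, isIntegral_algebraMap_iff (algebraMap ℚ K).injective] at hz
  obtain ⟨n, hn⟩ := IsIntegrallyClosed.isIntegral_iff.1 hz
  refine ⟨n, ?_⟩
  rw [← hq, ← hn]
  simp

lemma exists_rep (hdeg : Module.finrank ℚ K = 2) (d : ℤ) (hsf : Squarefree d)
    (hd4 : d % 4 = 3) (hns : ∀ n : ℤ, d ≠ n * n) (α : K) (hα : α * α = (d : K))
    (β : K) (hβ : IsIntegral ℤ β) : ∃ x y : ℤ, (x : K) + y * α = β := by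
  have : Algebra.IsQuadraticExtension ℚ K := ⟨hdeg⟩
  have hd0 : d ≠ 0 := by rintro rfl; simp at hd4
  have hdK : (d : K) ≠ 0 := by exact_mod_cast hd0
  have hα0 : α ≠ 0 := by rintro rfl; simp at hα; exact hd0 (by exact_mod_cast hα.symm)
  have hαi : IsIntegral ℤ α := by
    refine IsIntegral.of_pow (n := 2) two_pos ?_
    rw [pow_two, hα]; exact isIntegral_algebraMap (R := ℤ) (A := K) (x := d)
  obtain ⟨σ, hσ⟩ : ∃ σ : K ≃ₐ[ℚ] K, σ α ≠ α := by
    by_contra! hcon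
    obtain ⟨q, hq⟩ := (IsGalois.mem_range_algebraMap_iff_fixed (F := ℚ) α).2 hcon
    rw [← hq, isIntegral_algebraMap_iff (algebraMap ℚ K).injective] at hαi
    obtain ⟨n, hn⟩ := IsIntegrallyClosed.isIntegral_iff.1 hαi
    apply hns n
    rw [← hq, ← hn] at hα
    simp at hα
    exact_mod_cast hα.symm
  have hσ1 : σ ≠ 1 := by rintro rfl; simp at hσ
  have hσα : σ α = -α := by
    have h1 : σ α * σ α = α * α := by rw [← map_mul, hα, map_intCast]
    exact (mul_self_eq_mul_self_iff.1 h1).resolve_left hσ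
  have hinv : ∀ z, σ (σ z) = z := by
    have : Algebra.IsQuadraticExtension ℚ K := ⟨hdeg⟩
    have hcard : Nat.card (K ≃ₐ[ℚ] K) = 2 := by rw [IsGalois.card_aut_eq_finrank, hdeg]
    have h2 : σ ^ 2 = 1 := by rw [← hcard]; exact pow_card_eq_one'
    intro z
    have := congrArg (fun f => f z) h2
    simpa [pow_two] using this
  have hσβ : IsIntegral ℤ (σ β) := hβ.map σ.toAlgHom.toRingHom.toIntAlgHom
  obtain ⟨T, hT⟩ := int_of_fixed hdeg σ hσ1 (β + σ β) (hβ.add hσβ) (by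
    rw [map_add, hinv, add_comm])
  obtain ⟨N, hN⟩ := int_of_fixed hdeg σ hσ1 (β * σ β) (hβ.mul hσβ) (by
    rw [map_mul, hinv, mul_comm])
  obtain ⟨W, hW⟩ := int_of_fixed hdeg σ hσ1 ((β - σ β) * α) ((hβ.sub hσβ).mul hαi) (by
    rw [map_mul, map_sub, hinv, hσα]; ring)
  have e1 : W ^ 2 = d * (T ^ 2 - 4 * N) := by
    have : ((W : K)) ^ 2 = d * (T ^ 2 - 4 * N) := by
      rw [hW, hT, hN, ← hα]; ring
    exact_mod_cast this
  have e2 : d ∣ W := (hsf.dvd_pow_iff_dvd two_ne_zero).1 ⟨_, e1⟩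
  obtain ⟨V, rfl⟩ := e2
  have e3 : d * V ^ 2 = T ^ 2 - 4 * N := by
    apply mul_left_cancel₀ hd0
    rw [← e1]; ring
  have e4 : β - σ β = V * α := by
    apply mul_right_cancel₀ hα0
    rw [← hW, mul_assoc, hα]; push_cast; ring
  obtain ⟨k, hk⟩ : ∃ k, d = 4 * k + 3 := ⟨d / 4, by omega⟩
  have e5 : T ^ 2 - 3 * V ^ 2 = 4 * (N + k * V ^ 2) := by
    rw [hk] at e3; linarith
  have e6 : (2 : ℤ) ∣ T ∧ (2 : ℤ) ∣ V := by
    rcases Int.even_or_odd' T with ⟨t, rfl | rfl⟩ <;> rcases Int.even_or_odd' V with ⟨v, rfl | rfl⟩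
    · exact ⟨⟨t, rfl⟩, ⟨v, rfl⟩⟩
    all_goals
      exfalso
      ring_nf at e5
      omega
  obtain ⟨⟨t, rfl⟩, ⟨v, rfl⟩⟩ := e6
  refine ⟨t, v, ?_⟩
  push_cast at hT e4
  apply mul_left_cancel₀ (two_ne_zero (α := K))
  linear_combination hT - e4

open Zsqrtd in
lemma exists_equiv (hdeg : Module.finrank ℚ K = 2) (d : ℤ) (hsf : Squarefree d)
    (hd4 : d % 4 = 3) (hns : ∀ n : ℤ, d ≠ n * n) (α : K) (hα : α * α = (d : K)) :
    Nonempty (ℤ√d ≃+* 𝓞 K) := by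
  have hαi : IsIntegral ℤ α := by
    refine IsIntegral.of_pow (n := 2) two_pos ?_
    rw [pow_two, hα]; exact isIntegral_algebraMap (R := ℤ) (A := K) (x := d)
  let a : 𝓞 K := ⟨α, hαi⟩
  have ha : a * a = (d : 𝓞 K) := by
    apply RingOfIntegers.ext
    change algebraMap (𝓞 K) K (a * a) = algebraMap (𝓞 K) K d
    rw [map_mul, map_intCast]
    exact hα
  refine ⟨RingEquiv.ofBijective (Zsqrtd.lift ⟨a, ha⟩) ⟨Zsqrtd.lift_injective _ hns, ?_⟩⟩
  intro b
  obtain ⟨x, y, h⟩ := exists_rep hdeg d hsf hd4 hns α hα b b.isIntegral_coe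
  refine ⟨⟨x, y⟩, ?_⟩
  apply RingOfIntegers.ext
  change algebraMap (𝓞 K) K ((x : 𝓞 K) + (y : 𝓞 K) * a) = algebraMap (𝓞 K) K b
  rw [map_add, map_mul, map_intCast, map_intCast]
  exact h

end field

lemma principal_of_map {R S : Type*} [CommRing R] [CommRing S] (e : R ≃+* S) (I : Ideal R)
    (h : (I.map e).IsPrincipal) : I.IsPrincipal := by
  obtain ⟨b, hb⟩ := h
  refine ⟨e.symm b, ?_⟩
  have := congrArg (Ideal.map e.symm) hb
  rw [Ideal.submodule_span_eq, Ideal.map_span, Set.image_singleton] at this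
  rw [Ideal.submodule_span_eq, ← this]
  exact (Ideal.map_of_equiv e).symm

theorem class_number_ge_four (m : ℕ) (hm : 0 < m) (hm2 : Odd m) (hm3 : m % 3 = 2)
    (hsf : Squarefree (9 * m ^ 2 + 2 * m))
    (p : ℕ) (hp : p.Prime) (hp5 : 5 ≤ p) (hpm : p ∣ m)
    (K : Type) [Field K] [NumberField K]
    (hdeg : Module.finrank ℚ K = 2)
    (α : K) (hα : α ^ 2 = (9 * m ^ 2 + 2 * m : ℕ)) :
    4 ≤ classNumber K := by
  have hm5 : 5 ≤ (m : ℤ) := by exact_mod_cast hp5.trans (Nat.le_of_dvd hm hpm)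
  have hd4 : (9 * (m : ℤ) ^ 2 + 2 * m) % 4 = 3 := by
    obtain ⟨k, rfl⟩ := hm2
    push_cast
    ring_nf
    omega
  have hd3 : (9 * (m : ℤ) ^ 2 + 2 * m) % 3 = 1 := by omega
  have hsfZ : Squarefree (9 * (m : ℤ) ^ 2 + 2 * m) := by
    exact_mod_cast Int.squarefree_natCast.2 hsf
  have hns : ∀ n : ℤ, 9 * (m : ℤ) ^ 2 + 2 * m ≠ n * n := by
    intro n h
    have h1 := Int.isUnit_iff.1 (hsfZ n ⟨1, by rw [h]; ring⟩)
    rcases h1 with rfl | rfl <;> nlinarith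
  obtain ⟨e⟩ := exists_equiv hdeg (9 * (m : ℤ) ^ 2 + 2 * m) hsfZ hd4 hns α (by
    rw [← pow_two, hα]; push_cast; rfl)
  set I2 := Ideal.span {((2 : ℤ) : ℤ√(9 * (m : ℤ) ^ 2 + 2 * m)), 1 + Zsqrtd.sqrtd} with hI2
  set I3 := Ideal.span {((3 : ℤ) : ℤ√(9 * (m : ℤ) ^ 2 + 2 * m)), 1 + Zsqrtd.sqrtd} with hI3
  have n2 : ¬ (I2.map e).IsPrincipal := fun h =>
    two_not_principal m hm5 hd4 (principal_of_map e _ h)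
  have n3 : ¬ ((I3.map e) * (I3.map e)).IsPrincipal := fun h =>
    three_sq_not_principal m hm5 hd3 (principal_of_map e _ (by
      rw [Ideal.map_pow, pow_two (Ideal.map e _)]; exact h))
  have p2 : ((I2.map e) * (I2.map e)).IsPrincipal := by
    have h := pair_two hd4
    rw [pair_two_eq] at h
    rw [← Ideal.map_mul, h, Ideal.map_span, Set.image_singleton]
    exact ⟨_, rfl⟩
  have z2 : I2.map e ≠ ⊥ := by
    intro h; rw [h] at n2; exact n2 bot_isPrincipal
  have z3 : I3.map e ≠ ⊥ := by
    intro h; rw [h] at n3; exact n3 (by simpa using bot_isPrincipal)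
  have w2 := mem_nonZeroDivisors_of_ne_zero z2
  have w3 := mem_nonZeroDivisors_of_ne_zero z3
  refine group_four (ClassGroup.mk0 ⟨_, w2⟩) (ClassGroup.mk0 ⟨_, w3⟩) ?_ ?_ ?_
  · rwa [Ne, ClassGroup.mk0_eq_one_iff]
  · rw [← map_mul]
    exact (ClassGroup.mk0_eq_one_iff (mul_mem w2 w2)).2 p2
  · rw [← map_mul]
    exact fun h => n3 ((ClassGroup.mk0_eq_one_iff (mul_mem w3 w3)).1 h)
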